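/- arXiv:math/0703572 — 2 statements merged into one kernel-verified Lean document; each statement's English description precedes it below -/
import Mathlib

section
/- Let A be a commutative ring and let {φ_1,…,φ_p} be a regular sequence in A, i.e. for i = 1,…,p, φ_i is not a zero divisor of A/(φ_1,…,φ_{i−1}). Let I be the ideal of A generated by φ_1,…,φ_p. Suppose that for some q, q_1,…,q_h ∈ A one has φ_1^{i_1}⋯φ_p^{i_p}·q = Σ_{r=1}^h φ_1^{j_1(r)}⋯φ_p^{j_p(r)}·q_r, where (j_1(r),…,j_p(r)) > (i_1,…,i_p) in the lexicographic order on ℕ_0^p for every r = 1,…,h. Then q ∈ I. -/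
theorem stmt_9_cancel {A : Type*} [CommRing A] (J : Ideal A) (a : A)
    (h : ∀ x, a * x ∈ J → x ∈ J) (n : ℕ) : ∀ x, a ^ n * x ∈ J → x ∈ J := by
  induction n with
  | zero => intro x hx; simpa using hx
  | succ n ih =>
    intro x hx
    apply h
    apply ih
    rwa [pow_succ, mul_assoc] at hx

theorem stmt_9_aux {A : Type*} [CommRing A] (p : ℕ) : ∀ (J : Ideal A) (φ : Fin p → A)
    (_ : ∀ i : Fin p, ∀ x : A,
      φ i * x ∈ J ⊔ Ideal.span (φ '' {j | j < i}) → x ∈ J ⊔ Ideal.span (φ '' {j | j < i}))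
    (iE : Fin p → ℕ) (q : A)
    (_ : (∏ l, φ l ^ iE l) * q ∈ J ⊔ Ideal.span {m | ∃ j : Fin p → ℕ,
      (∃ k, (∀ l, l < k → iE l = j l) ∧ iE k < j k) ∧ m = ∏ l, φ l ^ j l}),
    q ∈ J ⊔ Ideal.span (Set.range φ) := by
  induction p with
  | zero =>
    intro J φ _ iE q hq
    have : {m | ∃ j : Fin 0 → ℕ,
      (∃ k, (∀ l, l < k → iE l = j l) ∧ iE k < j k) ∧ m = ∏ l, φ l ^ j l} = (∅ : Set A) := by
      ext m
      simp
    rw [this] at hq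
    simpa using hq
  | succ p ih =>
    intro J φ hreg iE q hq
    have h0 : ∀ x, φ 0 * x ∈ J → x ∈ J := by
      intro x hx
      have := hreg 0 x
      simpa [hx] using this
    have himg : ∀ i : Fin p, φ '' {j | j < i.succ} =
        {φ 0} ∪ (fun l : Fin p => φ l.succ) '' {j | j < i} := by
      intro i
      ext y
      simp only [Set.mem_image, Set.mem_setOf_eq, Set.mem_union, Set.mem_singleton_iff,
        Fin.exists_fin_succ, Fin.succ_lt_succ_iff, Fin.succ_pos, true_and]
      simp [eq_comm]
    have hrange : Set.range φ = {φ 0} ∪ Set.range (fun l : Fin p => φ l.succ) := by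
      ext y
      simp only [Set.mem_range, Set.mem_union, Set.mem_singleton_iff, Fin.exists_fin_succ]
      simp [eq_comm]
    rw [hrange, Ideal.span_union, ← sup_assoc]
    apply ih (J ⊔ Ideal.span {φ 0}) (fun l => φ l.succ) ?_ (fun l => iE l.succ) q
    · set T := J ⊔ Ideal.span {φ 0} ⊔ Ideal.span {m | ∃ j : Fin p → ℕ,
        (∃ k, (∀ l, l < k → iE l.succ = j l) ∧ iE k.succ < j k) ∧ m = ∏ l, φ l.succ ^ j l}
        with hT
      have hle : J ⊔ Ideal.span {m | ∃ j : Fin (p+1) → ℕ,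
          (∃ k, (∀ l, l < k → iE l = j l) ∧ iE k < j k) ∧ m = ∏ l, φ l ^ j l} ≤
          J ⊔ Ideal.span {φ 0 ^ iE 0} * T := by
        refine sup_le le_sup_left ((Ideal.span_le.2 ?_).trans le_sup_right)
        rintro m ⟨j, ⟨k, hk, hlt⟩, rfl⟩
        rw [SetLike.mem_coe, Ideal.mem_span_singleton_mul, Fin.prod_univ_succ]
        induction k using Fin.cases with
        | zero =>
          obtain ⟨d, hd⟩ := Nat.exists_eq_add_of_lt hlt
          refine ⟨φ 0 * (φ 0 ^ d * ∏ l : Fin p, φ l.succ ^ j l.succ), ?_, ?_⟩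
          · apply Ideal.mul_mem_right
            exact Ideal.mem_sup_left (Ideal.mem_sup_right (Ideal.mem_span_singleton_self _))
          · rw [hd]; ring
        | succ k =>
          refine ⟨∏ l : Fin p, φ l.succ ^ j l.succ, ?_, ?_⟩
          · refine Ideal.mem_sup_right (Ideal.subset_span ⟨fun l => j l.succ, ⟨k, ?_, hlt⟩, rfl⟩)
            intro l hl
            exact hk _ (Fin.succ_lt_succ_iff.2 hl)
          · rw [hk 0 (Fin.succ_pos k)]
      obtain ⟨y, hy, z, hz, hyz⟩ := Submodule.mem_sup.1 (hle hq)
      obtain ⟨s, hs, rfl⟩ := Ideal.mem_span_singleton_mul.1 hz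
      rw [Fin.prod_univ_succ] at hyz
      have h1 : (∏ l : Fin p, φ l.succ ^ iE l.succ) * q - s ∈ J := by
        apply stmt_9_cancel J (φ 0) h0 (iE 0)
        have : φ 0 ^ iE 0 * ((∏ l : Fin p, φ l.succ ^ iE l.succ) * q - s) = y := by
          linear_combination -hyz
        rwa [this]
      have h2 : (∏ l : Fin p, φ l.succ ^ iE l.succ) * q - s ∈ T :=
        Ideal.mem_sup_left (Ideal.mem_sup_left h1)
      have := T.add_mem h2 hs
      rwa [sub_add_cancel] at this
    · intro i x
      have := hreg i.succ x
      rwa [himg, Ideal.span_union, ← sup_assoc] at this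

/- STATEMENT 9:
Let A be a commutative ring and {φ_1,…,φ_p} a regular sequence in A (φ_i is not a zero
divisor of A/(φ_1,…,φ_{i−1})).  Let I be the ideal generated by φ_1,…,φ_p.  If
φ_1^{i_1}⋯φ_p^{i_p}·q = Σ_{r=1}^h φ_1^{j_1(r)}⋯φ_p^{j_p(r)}·q_r with
(j_1(r),…,j_p(r)) > (i_1,…,i_p) lexicographically for every r, then q ∈ I. -/
theorem stmt_9 {A : Type*} [CommRing A] {p : ℕ} (φ : Fin p → A)
    (hreg : ∀ i : Fin p, ∀ x : A,
      φ i * x ∈ Ideal.span (φ '' {j | j < i}) → x ∈ Ideal.span (φ '' {j | j < i}))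
    {h : ℕ} (iE : Fin p → ℕ) (jE : Fin h → Fin p → ℕ) (q : A) (qr : Fin h → A)
    (hlex : ∀ r, toLex iE < toLex (jE r))
    (heq : (∏ l, φ l ^ iE l) * q = ∑ r, (∏ l, φ l ^ jE r l) * qr r) :
    q ∈ Ideal.span (Set.range φ) := by
  have := stmt_9_aux p ⊥ φ (by simpa using hreg) iE q ?_
  · simpa using this
  · rw [heq]
    apply Ideal.mem_sup_right
    refine Ideal.sum_mem _ fun r _ => Ideal.mul_mem_right _ _ (Ideal.subset_span ?_)
    obtain ⟨k, hk, hlt⟩ := hlex r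
    exact ⟨jE r, ⟨k, fun l hl => hk l hl, hlt⟩, rfl⟩
end

section
/- Let δ ∈ (0,1) and let K ≥ 3 be an integer, and set p_0 = ⌊((K−1)·log K / log(1+δ) + 1)²⌋. Let (t_p)_{p≥1} be a nondecreasing sequence of real numbers with t_1 ≥ 1 such that t_{p_0+1} < (K + p_0)^{K−1} and such that log(K + p_0) ≤ log K · log p_0 and log p_0 ≤ √p_0. Then there exists a positive integer p ≤ p_0 with t_{p+1}/t_p < 1 + δ. -/
/- STATEMENT 17:
Let δ ∈ (0,1), K ≥ 3 an integer, p₀ = ⌊((K−1)·log K / log(1+δ) + 1)²⌋.  Let (t_p) be a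
nondecreasing sequence of reals with t_1 ≥ 1, t_{p₀+1} < (K+p₀)^{K−1},
log(K+p₀) ≤ log K · log p₀ and log p₀ ≤ √p₀.  Then there is a positive integer p ≤ p₀
with t_{p+1}/t_p < 1 + δ. -/
theorem stmt_17 (δ : ℝ) (hδ0 : 0 < δ) (hδ1 : δ < 1) (K : ℕ) (hK : 3 ≤ K)
    (p₀ : ℕ)
    (hp₀ : p₀ = Nat.floor ((((K : ℝ) - 1) * Real.log K / Real.log (1 + δ) + 1) ^ 2))
    (t : ℕ → ℝ) (hmono : Monotone t) (ht1 : 1 ≤ t 1)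
    (htb : t (p₀ + 1) < ((K : ℝ) + p₀) ^ (K - 1))
    (hlog1 : Real.log ((K : ℝ) + p₀) ≤ Real.log K * Real.log p₀)
    (hlog2 : Real.log p₀ ≤ Real.sqrt p₀) :
    ∃ p : ℕ, 1 ≤ p ∧ p ≤ p₀ ∧ t (p + 1) / t p < 1 + δ := by
  by_contra hcon
  push Not at hcon
  have hL : 0 < Real.log (1 + δ) := Real.log_pos (by linarith)
  have hK' : (3 : ℝ) ≤ K := by exact_mod_cast hK
  have hlK : 0 < Real.log K := Real.log_pos (by linarith)
  have hgrow : ∀ m : ℕ, m ≤ p₀ → (1 + δ) ^ m ≤ t (m + 1) := by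
    intro m
    induction m with
    | zero => intro _; simpa using ht1
    | succ k ih =>
      intro hk
      have h1 := ih (by omega)
      have h2 := hcon (k + 1) (by omega) hk
      have h3 : 0 < t (k + 1) := lt_of_lt_of_le (by positivity) h1
      rw [le_div_iff₀ h3] at h2
      calc (1 + δ) ^ (k + 1) = (1 + δ) * (1 + δ) ^ k := by ring
        _ ≤ (1 + δ) * t (k + 1) := by gcongr
        _ ≤ _ := h2
  have hlt : (1 + δ) ^ p₀ < ((K : ℝ) + p₀) ^ (K - 1) := lt_of_le_of_lt (hgrow p₀ le_rfl) htb
  have hlog := Real.log_lt_log (by positivity) hlt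
  rw [Real.log_pow, Real.log_pow, Nat.cast_sub (by omega : 1 ≤ K), Nat.cast_one] at hlog
  have hfl := Nat.lt_floor_add_one ((((K : ℝ) - 1) * Real.log K / Real.log (1 + δ) + 1) ^ 2)
  rw [← hp₀] at hfl
  obtain ⟨A, hA⟩ : ∃ A, A = ((K : ℝ) - 1) * Real.log K / Real.log (1 + δ) := ⟨_, rfl⟩
  rw [← hA] at hfl
  have hApos : 0 < A := by
    rw [hA]
    exact div_pos (mul_pos (by linarith) hlK) hL
  have hAL : A * Real.log (1 + δ) = ((K : ℝ) - 1) * Real.log K := by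
    rw [hA]; field_simp
  have hs0 := Real.sqrt_nonneg (p₀ : ℝ)
  have hss := Real.mul_self_sqrt (Nat.cast_nonneg (α := ℝ) p₀)
  have hchain : (p₀ : ℝ) * Real.log (1 + δ) < A * Real.log (1 + δ) * Real.sqrt p₀ := by
    rw [hAL]
    calc (p₀ : ℝ) * Real.log (1 + δ) < ((K : ℝ) - 1) * Real.log (K + p₀) := hlog
      _ ≤ ((K : ℝ) - 1) * (Real.log K * Real.sqrt p₀) := by
        apply mul_le_mul_of_nonneg_left _ (by linarith)
        exact hlog1.trans (mul_le_mul_of_nonneg_left hlog2 hlK.le)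
      _ = _ := by ring
  have h5 : (p₀ : ℝ) < A * Real.sqrt p₀ := by
    refine lt_of_mul_lt_mul_right ?_ hL.le
    linarith [mul_right_comm A (Real.log (1 + δ)) (Real.sqrt p₀)]
  have h6 : A < Real.sqrt p₀ := by
    apply Real.lt_sqrt_of_sq_lt
    nlinarith
  nlinarith
end
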